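/- The su_q^P(3) coproduct respects the Cartan brackets: for each i ∈ {1,2,3} and each root pair jk ∈ {12,21,23,32,13,31}, as functions on ℝ⁹×ℝ⁹ one has {Δ(hᵢ), Δ(a_{jk})} = (δᵢⱼ − δᵢₖ)·Δ(a_{jk}), where the bracket on the left is the product Poisson bracket. -/

import Mathlib

/-- Partial derivative of a function on ℝ⁹ in the `i`-th coordinate direction.
Coordinates: (x 0,…,x 8) = (h₁,h₂,h₃,a₁₂,a₂₁,a₂₃,a₃₂,a₁₃,a₃₁). -/
noncomputable def pd (i : Fin 9) (f : (Fin 9 → ℝ) → ℝ) (x : Fin 9 → ℝ) : ℝ :=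
  fderiv ℝ f x (Pi.single i 1)

/-- The structure functions π(u,v) of su_q^P(3) for u < v (zero otherwise);
indices: 0=h₁, 1=h₂, 2=h₃, 3=a₁₂, 4=a₂₁, 5=a₂₃, 6=a₃₂, 7=a₁₃, 8=a₃₁. -/
noncomputable def piU (z : ℝ) (u v : ℕ) (x : Fin 9 → ℝ) : ℝ :=
  match u, v with
  | 0, 3 => x 3
  | 0, 4 => -x 4
  | 0, 7 => x 7
  | 0, 8 => -x 8
  | 1, 3 => -x 3
  | 1, 4 => x 4
  | 1, 5 => x 5
  | 1, 6 => -x 6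
  | 2, 5 => -x 5
  | 2, 6 => x 6
  | 2, 7 => -x 7
  | 2, 8 => x 8
  | 3, 4 => Real.sinh (z * (x 0 - x 1)) / z
  | 3, 5 => x 7
  | 3, 7 => z ^ 2 * x 3 ^ 2 * x 5
  | 3, 8 => -(Real.cosh (z * (x 0 - x 1)) * x 6)
  | 4, 6 => -x 8
  | 4, 7 => Real.cosh (z * (x 0 - x 1)) * x 5
  | 4, 8 => -(z ^ 2 * x 4 ^ 2 * x 6)
  | 5, 6 => Real.sinh (z * (x 1 - x 2)) / z
  | 5, 7 => -(z ^ 2 * x 5 ^ 2 * x 3)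
  | 5, 8 => Real.cosh (z * (x 1 - x 2)) * x 4
  | 6, 7 => -(Real.cosh (z * (x 1 - x 2)) * x 3)
  | 6, 8 => z ^ 2 * x 6 ^ 2 * x 4
  | 7, 8 => Real.sinh (z * (x 0 - x 2)) / z
      + z * Real.sinh (z * (x 0 - x 1)) * x 5 * x 6
      + z * Real.sinh (z * (x 1 - x 2)) * x 3 * x 4
  | _, _ => 0

/-- The bracket of the q-Poisson algebra su_q^P(3):
{f,g} = Σ_{u<v} π(u,v)(∂_u f ∂_v g − ∂_v f ∂_u g). -/
noncomputable def suq3Bracket (z : ℝ) (f g : (Fin 9 → ℝ) → ℝ) (x : Fin 9 → ℝ) : ℝ :=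
  ∑ u : Fin 9, ∑ v : Fin 9,
    if u < v then piU z u.val v.val x * (pd u f x * pd v g x - pd v f x * pd u g x)
    else 0

/-- The product Poisson bracket on ℝ⁹ × ℝ⁹. -/
noncomputable def suq3Bracket2 (z : ℝ) (F G : (Fin 9 → ℝ) × (Fin 9 → ℝ) → ℝ)
    (p : (Fin 9 → ℝ) × (Fin 9 → ℝ)) : ℝ :=
  suq3Bracket z (fun y => F (y, p.2)) (fun y => G (y, p.2)) p.1
  + suq3Bracket z (fun y => F (p.1, y)) (fun y => G (p.1, y)) p.2

/-- Coproduct Δ(hᵢ) = hᵢ + hᵢ' (i = 0,1,2 standing for 1,2,3). -/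
noncomputable def Dh (i : Fin 3) : (Fin 9 → ℝ) × (Fin 9 → ℝ) → ℝ := fun p =>
  p.1 ⟨i.val, by omega⟩ + p.2 ⟨i.val, by omega⟩

/-- Coproduct Δ(a₁₂). -/
noncomputable def Da12 (z : ℝ) : (Fin 9 → ℝ) × (Fin 9 → ℝ) → ℝ := fun p =>
  Real.exp (z * (p.1 0 - p.1 1) / 2) * p.2 3
  + p.1 3 * Real.exp (-(z * (p.2 0 - p.2 1) / 2))

/-- Coproduct Δ(a₂₁). -/
noncomputable def Da21 (z : ℝ) : (Fin 9 → ℝ) × (Fin 9 → ℝ) → ℝ := fun p =>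
  Real.exp (z * (p.1 0 - p.1 1) / 2) * p.2 4
  + p.1 4 * Real.exp (-(z * (p.2 0 - p.2 1) / 2))

/-- Coproduct Δ(a₂₃). -/
noncomputable def Da23 (z : ℝ) : (Fin 9 → ℝ) × (Fin 9 → ℝ) → ℝ := fun p =>
  Real.exp (z * (p.1 1 - p.1 2) / 2) * p.2 5
  + p.1 5 * Real.exp (-(z * (p.2 1 - p.2 2) / 2))

/-- Coproduct Δ(a₃₂). -/
noncomputable def Da32 (z : ℝ) : (Fin 9 → ℝ) × (Fin 9 → ℝ) → ℝ := fun p =>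
  Real.exp (z * (p.1 1 - p.1 2) / 2) * p.2 6
  + p.1 6 * Real.exp (-(z * (p.2 1 - p.2 2) / 2))

/-- Coproduct Δ(a₁₃). -/
noncomputable def Da13 (z : ℝ) : (Fin 9 → ℝ) × (Fin 9 → ℝ) → ℝ := fun p =>
  Real.exp (z * (p.1 0 - p.1 2) / 2) * p.2 7
  + p.1 7 * Real.exp (-(z * (p.2 0 - p.2 2) / 2))
  + z * (Real.exp (z * (p.1 1 - p.1 2) / 2) * p.1 3
           * (Real.exp (-(z * (p.2 0 - p.2 1) / 2)) * p.2 5)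
         - Real.exp (z * (p.1 0 - p.1 1) / 2) * p.1 5
           * (Real.exp (-(z * (p.2 1 - p.2 2) / 2)) * p.2 3))

/-- Coproduct Δ(a₃₁). -/
noncomputable def Da31 (z : ℝ) : (Fin 9 → ℝ) × (Fin 9 → ℝ) → ℝ := fun p =>
  Real.exp (z * (p.1 0 - p.1 2) / 2) * p.2 8
  + p.1 8 * Real.exp (-(z * (p.2 0 - p.2 2) / 2))
  + z * (Real.exp (z * (p.1 1 - p.1 2) / 2) * p.1 4
           * (Real.exp (-(z * (p.2 0 - p.2 1) / 2)) * p.2 6)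
         - Real.exp (z * (p.1 0 - p.1 1) / 2) * p.1 6
           * (Real.exp (-(z * (p.2 1 - p.2 2) / 2)) * p.2 4))

/-- Coproduct of the root generator with coordinate index k ∈ {3,…,8}. -/
noncomputable def Droot (z : ℝ) (k : ℕ) : (Fin 9 → ℝ) × (Fin 9 → ℝ) → ℝ :=
  match k with
  | 3 => Da12 z
  | 4 => Da21 z
  | 5 => Da23 z
  | 6 => Da32 z
  | 7 => Da13 z
  | _ => Da31 z

/-- The (zero-based) subscripts (j,k) of the root generator a_{jk} with
coordinate index 3 ↦ (1,2), 4 ↦ (2,1), 5 ↦ (2,3), 6 ↦ (3,2), 7 ↦ (1,3), 8 ↦ (3,1). -/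
def rootSub (k : ℕ) : Fin 3 × Fin 3 :=
  match k with
  | 3 => (0, 1)
  | 4 => (1, 0)
  | 5 => (1, 2)
  | 6 => (2, 1)
  | 7 => (0, 2)
  | _ => (2, 0)

/-- The weights of the nine coordinates under the adjoint action of the Cartan generator `hᵢ`. -/
def cartanWeight (i : Fin 3) : Fin 9 → ℝ :=
  match i with
  | 0 => ![0, 0, 0, 1, -1, 0, 0, 1, -1]
  | 1 => ![0, 0, 0, -1, 1, 1, -1, 0, 0]
  | 2 => ![0, 0, 0, 0, 0, -1, 1, -1, 1]

theorem pd_coord_add_const (u j : Fin 9) (c : ℝ) (x : Fin 9 → ℝ) :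
    pd u (fun y => y j + c) x = if u = j then 1 else 0 := by
  have h : HasFDerivAt (fun y : Fin 9 → ℝ => y j + c)
      (ContinuousLinearMap.proj (R := ℝ) (φ := fun _ : Fin 9 => ℝ) j) x :=
    (hasFDerivAt_apply j x).add_const c
  simp [pd, h.fderiv, Pi.single_apply, eq_comm]

/-- The Hamiltonian vector field of `hᵢ` is the diagonal field with weights `cartanWeight i`. -/
theorem suq3Bracket_cartan (z : ℝ) (i : Fin 3) (c : ℝ) (g : (Fin 9 → ℝ) → ℝ) (x : Fin 9 → ℝ) :
    suq3Bracket z (fun y => y ⟨i.val, by omega⟩ + c) g x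
      = fderiv ℝ g x (cartanWeight i * x) := by
  have h : fderiv ℝ g x (cartanWeight i * x)
      = ∑ v : Fin 9, (cartanWeight i v * x v) * pd v g x := by
    conv_lhs => rw [pi_eq_sum_univ' (cartanWeight i * x)]
    simp [pd, Pi.single]
  rw [h]
  simp only [suq3Bracket, pd_coord_add_const]
  fin_cases i <;> simp [Fin.sum_univ_succ, piU, cartanWeight]

/-- The bracket of `hᵢ` with a function that is affine along the Hamiltonian direction is the
increment of that function. -/
theorem suq3Bracket_cartan_of_affine (z : ℝ) (i : Fin 3) (c : ℝ) {g : (Fin 9 → ℝ) → ℝ}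
    {x : Fin 9 → ℝ} (hg : DifferentiableAt ℝ g x)
    (h : ∀ t : ℝ, g (x + t • (cartanWeight i * x))
      = g x + t * (g (x + cartanWeight i * x) - g x)) :
    suq3Bracket z (fun y => y ⟨i.val, by omega⟩ + c) g x
      = g (x + cartanWeight i * x) - g x := by
  rw [suq3Bracket_cartan, ← hg.lineDeriv_eq_fderiv]
  simp [lineDeriv, h]

/-- the su_q^P(3) coproduct respects the Cartan brackets:
{Δ(hᵢ), Δ(a_{jk})} = (δᵢⱼ − δᵢₖ)·Δ(a_{jk}). -/
theorem suq3_coproduct_cartan (z : ℝ) (hz : z ≠ 0) :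
    ∀ (i : Fin 3) (k : ℕ), 3 ≤ k → k ≤ 8 →
      ∀ p : (Fin 9 → ℝ) × (Fin 9 → ℝ),
        suq3Bracket2 z (Dh i) (Droot z k) p
          = ((if i = (rootSub k).1 then (1 : ℝ) else 0)
             - (if i = (rootSub k).2 then (1 : ℝ) else 0)) * Droot z k p := by
  intro i k hk₃ hk₈ p
  have bracket_eq (G : (Fin 9 → ℝ) × (Fin 9 → ℝ) → ℝ) (hG : Differentiable ℝ G)
      (h₁ : ∀ t : ℝ, G (p.1 + t • (cartanWeight i * p.1), p.2)
        = G p + t * (G (p.1 + cartanWeight i * p.1, p.2) - G p))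
      (h₂ : ∀ t : ℝ, G (p.1, p.2 + t • (cartanWeight i * p.2))
        = G p + t * (G (p.1, p.2 + cartanWeight i * p.2) - G p)) :
      suq3Bracket2 z (Dh i) G p
        = (G (p.1 + cartanWeight i * p.1, p.2) - G p)
          + (G (p.1, p.2 + cartanWeight i * p.2) - G p) := by
    have e₁ := suq3Bracket_cartan_of_affine z i (p.2 ⟨i.val, by omega⟩)
      (g := fun y => G (y, p.2)) (x := p.1) (by fun_prop) h₁
    have e₂ := suq3Bracket_cartan_of_affine z i (p.1 ⟨i.val, by omega⟩)
      (g := fun y => G (p.1, y)) (x := p.2) (by fun_prop) h₂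
    simp only [suq3Bracket2, Dh]
    rw [e₁]
    simp only [add_comm (p.1 _)]
    rw [e₂]
  have hdiff : Differentiable ℝ (Droot z k) := by
    interval_cases k <;> simp only [Droot] <;>
      [unfold Da12; unfold Da21; unfold Da23; unfold Da32; unfold Da13; unfold Da31] <;> fun_prop
  rw [bracket_eq _ hdiff] <;> clear bracket_eq hdiff
  all_goals
    interval_cases k <;> fin_cases i <;>
    simp [Droot, Da12, Da21, Da23, Da32, Da13, Da31, rootSub, cartanWeight] <;> intros <;> ring
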